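/- For p > 1 and E an infinite-dimensional Banach space, the identity operator id_E : E → E is not almost p-summing at 0, i.e., there is no constant C with (∫_0^1 ‖Σ_{j=1}^k x_j r_j(t)‖² dt)^{1/2} ≤ C ‖(x_j)_{j=1}^k‖_{w,p} for all finite families (x_j) in E. -/

import Mathlib

open MeasureTheory Filter Finset

/-- The weak ℓ_q norm of a finite family: `sup_{‖φ‖≤1} (∑ |φ x_j|^q)^{1/q}`. -/
noncomputable def weakNorm {E : Type*} [NormedAddCommGroup E] [NormedSpace ℝ E]
    (q : ℝ) {k : ℕ} (x : Fin k → E) : ℝ :=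
  sSup {s : ℝ | ∃ φ : E →L[ℝ] ℝ, ‖φ‖ ≤ 1 ∧ s = (∑ j, |φ (x j)| ^ q) ^ (1 / q)}

/-- The weak ℓ_q norm of a sequence. -/
noncomputable def weakNormSeq {E : Type*} [NormedAddCommGroup E] [NormedSpace ℝ E]
    (q : ℝ) (x : ℕ → E) : ℝ :=
  sSup {s : ℝ | ∃ φ : E →L[ℝ] ℝ, ‖φ‖ ≤ 1 ∧ s = (∑' j, |φ (x j)| ^ q) ^ (1 / q)}

/-- Unconditionally q-summable sequences: weakly q-summable with weak norms of tails → 0. -/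
def UncondSummable {E : Type*} [NormedAddCommGroup E] [NormedSpace ℝ E]
    (q : ℝ) (x : ℕ → E) : Prop :=
  (∀ φ : E →L[ℝ] ℝ, Summable fun j => |φ (x j)| ^ q) ∧
    Tendsto (fun m => weakNormSeq q fun j => x (j + m)) atTop (nhds 0)

/-- The Rademacher functions on [0,1]. -/
noncomputable def rademacher (j : ℕ) (t : ℝ) : ℝ :=
  if Int.fract ((2 : ℝ) ^ j * t) < 1 / 2 then 1 else -1

/-- `(∫_0^1 ‖∑_j r_j(t) y_j‖² dt)^{1/2}` for a finite family `y` in `F`. -/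
noncomputable def radNorm {F : Type*} [NormedAddCommGroup F] [NormedSpace ℝ F]
    {k : ℕ} (y : Fin k → F) : ℝ :=
  (∫ t in (0:ℝ)..1, ‖∑ j : Fin k, rademacher (j : ℕ) t • y j‖ ^ 2) ^ ((1:ℝ) / 2)

/-- `f` is almost p-summing at `a`. -/
def AlmostSummingAt {E F : Type*} [NormedAddCommGroup E] [NormedSpace ℝ E]
    [NormedAddCommGroup F] [NormedSpace ℝ F] (p : ℝ) (f : E → F) (a : E) : Prop :=
  ∃ C > 0, ∃ ε > 0, ∃ r > 0, ∀ (k : ℕ) (x : Fin k → E), weakNorm p x < ε →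
    radNorm (fun j => f (a + x j) - f a) ≤ C * weakNorm p x ^ r

/-- `f` is absolutely (p,q)-summing at `a`. -/
def AbsSummingAt {E F : Type*} [NormedAddCommGroup E] [NormedSpace ℝ E]
    [NormedAddCommGroup F] [NormedSpace ℝ F] (p q : ℝ) (f : E → F) (a : E) : Prop :=
  ∃ M > 0, ∃ δ > 0, ∃ r > 0, ∀ (k : ℕ) (x : Fin k → E), weakNorm q x < δ →
    (∑ j, ‖f (a + x j) - f a‖ ^ p) ≤ M * weakNorm q x ^ r

theorem det_one_add_proj {V : Type*} [NormedAddCommGroup V] [InnerProductSpace ℝ V]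
    [FiniteDimensional ℝ V] (K : Submodule ℝ V) :
    LinearMap.det ((1 + K.starProjection : V →L[ℝ] V) : V →ₗ[ℝ] V)
      = 2 ^ Module.finrank ℝ K := by
  let e := K.prodEquivOfIsCompl _ K.isCompl_orthogonal
  let b := (Module.finBasis ℝ K).prod (Module.finBasis ℝ Kᗮ)
  have : LinearMap.toMatrix b b
      (e.symm ∘ₗ ((1 + K.starProjection : V →L[ℝ] V) : V →ₗ[ℝ] V) ∘ₗ e.symm.symm) =
      Matrix.fromBlocks ((2:ℝ) • 1) 0 0 1 := by
    have h1 : ∀ x : K, e.symm (x : V) = (x, 0) := fun x => by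
      rw [LinearEquiv.symm_apply_eq]; simp [e]
    have h2 : ∀ x : Kᗮ, e.symm (x : V) = (0, x) := fun x => by
      rw [LinearEquiv.symm_apply_eq]; simp [e]
    have h3 : ∀ x : K, K.starProjection (x : V) = x := fun x =>
      Submodule.starProjection_eq_self_iff.2 x.2
    have h4 : ∀ x : Kᗮ, K.starProjection (x : V) = 0 := fun x =>
      (Submodule.starProjection_apply_eq_zero_iff K).2 x.2
    have e1 : ∀ x : K, e (x, 0) = x := fun x => by simp [e]
    have e2 : ∀ x : Kᗮ, e (0, x) = x := fun x => by simp [e]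
    ext (i | i) (j | j) <;>
    simp [LinearMap.toMatrix_apply, b, Matrix.one_apply, Finsupp.single_apply, eq_comm, e1, e2,
      h1, h2, h3, h4]
    split_ifs <;> norm_num
  rw [← LinearMap.det_conj _ e.symm, ← LinearMap.det_toMatrix b, this,
    Matrix.det_fromBlocks_zero₂₁, Matrix.det_one, mul_one, Matrix.det_smul, Matrix.det_one,
    Fintype.card_fin, mul_one]

theorem dr_operator {E : Type*} [NormedAddCommGroup E] [NormedSpace ℝ E]
    (hE : ¬ FiniteDimensional ℝ E) (n : ℕ) :
    ∃ U : EuclideanSpace ℝ (Fin n) →L[ℝ] E, ‖U‖ ≤ 1 ∧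
      ∀ W : Submodule ℝ (EuclideanSpace ℝ (Fin n)), 0 < Module.finrank ℝ W →
        n ≤ 2 * Module.finrank ℝ W →
        ∃ w ∈ W, ‖w‖ = 1 ∧ 2 / 5 ≤ ‖U w‖ := by
  set V := EuclideanSpace ℝ (Fin n) with hV
  obtain ⟨f, hf⟩ : ∃ f : Fin n → E, LinearIndependent ℝ f := by
    apply exists_linearIndependent_of_le_rank
    have : Cardinal.aleph0 ≤ Module.rank ℝ E := by
      rw [← not_lt, Module.rank_lt_aleph0_iff]; exact hE
    exact (Cardinal.natCast_le_aleph0).trans this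
  let T0 : V →ₗ[ℝ] E := (Fintype.linearCombination ℝ f) ∘ₗ
    (WithLp.linearEquiv 2 ℝ (Fin n → ℝ)).toLinearMap
  have hT0 : Function.Injective T0 := by
    have := hf.fintypeLinearCombination_injective
    exact this.comp (WithLp.linearEquiv 2 ℝ (Fin n → ℝ)).injective
  let T : V →L[ℝ] E := LinearMap.toContinuousLinearMap T0
  obtain ⟨κ, hκ, hanti⟩ := LinearMap.exists_antilipschitzWith T0 (LinearMap.ker_eq_bot.2 hT0)
  have hanti' : ∀ v, ‖v‖ ≤ κ * ‖T v‖ := fun v => by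
    have := hanti.le_mul_dist v 0
    simpa [dist_eq_norm, T] using this
  let S : Set (V →L[ℝ] V) := {A | ‖T ∘L A‖ ≤ 1}
  have hSc : IsCompact S := by
    have : ProperSpace (V →L[ℝ] V) := FiniteDimensional.proper ℝ _
    apply Metric.isCompact_of_isClosed_isBounded
    · exact isClosed_le (by fun_prop) continuous_const
    · rw [isBounded_iff_forall_norm_le]
      refine ⟨κ, fun A hA => ?_⟩
      refine ContinuousLinearMap.opNorm_le_bound _ κ.2 fun v => ?_
      refine (hanti' _).trans ?_
      have : ‖(T ∘L A) v‖ ≤ 1 * ‖v‖ := ContinuousLinearMap.le_of_opNorm_le _ hA v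
      simp only [one_mul, ContinuousLinearMap.comp_apply] at this
      exact mul_le_mul_of_nonneg_left this κ.2
  obtain ⟨A, hAS, hAmax⟩ := hSc.exists_isMaxOn (f := fun A : V →L[ℝ] V => |A.det|)
    ⟨0, by simp [S]⟩ (ContinuousLinearMap.continuous_det.abs.continuousOn)
  have hpos : 0 < |A.det| := by
    let c : ℝ := (‖T‖ + 1)⁻¹
    have hc : 0 < c := by positivity
    have hmem : (c • (1 : V →L[ℝ] V)) ∈ S := by
      change ‖T ∘L (c • (1 : V →L[ℝ] V))‖ ≤ 1
      rw [ContinuousLinearMap.comp_smul, norm_smul]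
      change ‖c‖ * ‖T‖ ≤ 1
      rw [Real.norm_of_nonneg hc.le, inv_mul_le_iff₀ (by positivity)]
      linarith
    refine lt_of_lt_of_le ?_ (hAmax hmem)
    simp only [ContinuousLinearMap.det, ContinuousLinearMap.toLinearMap_smul, LinearMap.det_smul]
    have : LinearMap.det ((1 : V →L[ℝ] V) : V →ₗ[ℝ] V) = 1 := LinearMap.det_id
    rw [this]; positivity
  refine ⟨T ∘L A, hAS, fun W hW0 hW => ?_⟩
  by_contra! hcon
  have hsm : ∀ w ∈ W, ‖T (A w)‖ ≤ 2 / 5 * ‖w‖ := by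
    intro w hw
    by_cases h0 : w = 0
    · simp [h0]
    have hn : 0 < ‖w‖ := norm_pos_iff.2 h0
    have := hcon (‖w‖⁻¹ • w) (W.smul_mem _ hw) (by rw [norm_smul, norm_inv, norm_norm, inv_mul_cancel₀ hn.ne'])
    simp only [map_smul, norm_smul, norm_inv, norm_norm, ContinuousLinearMap.comp_apply] at this
    rw [inv_mul_lt_iff₀ hn] at this
    linarith
  have hmem : ((5 / 7 : ℝ) • (A ∘L (1 + W.starProjection))) ∈ S := by
    change ‖T ∘L _‖ ≤ 1
    refine ContinuousLinearMap.opNorm_le_bound _ zero_le_one fun v => ?_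
    have h1 : ‖T (A v)‖ ≤ 1 * ‖v‖ := ContinuousLinearMap.le_of_opNorm_le _ hAS v
    have h2 := hsm (W.starProjection v) (Submodule.starProjection_apply_mem _ _)
    have h3 : ‖W.starProjection v‖ ≤ ‖v‖ := Submodule.norm_starProjection_apply_le W v
    have h4 := norm_add_le (T (A v)) (T (A (W.starProjection v)))
    simp only [ContinuousLinearMap.comp_apply, smul_apply, map_smul, norm_smul,
      add_apply, map_add, one_apply_eq_self]
    rw [Real.norm_of_nonneg (by norm_num)]
    linarith
  have h := hAmax hmem
  simp only [Set.mem_ofPred_eq, ContinuousLinearMap.det, ContinuousLinearMap.toLinearMap_smul,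
    LinearMap.det_smul, ContinuousLinearMap.toLinearMap_comp, LinearMap.det_comp] at h
  rw [det_one_add_proj, abs_mul, abs_mul] at h
  have hfr : Module.finrank ℝ V = n := by simp [V]
  rw [hfr, abs_of_pos (by positivity : (0:ℝ) < (5/7)^n),
    abs_of_pos (by positivity : (0:ℝ) < 2 ^ Module.finrank ℝ W)] at h
  change _ ≤ |A.det| at h
  change _ * (|A.det| * _) ≤ |A.det| at h
  set k := Module.finrank ℝ W
  have h5 : (1:ℝ) < (5/7)^n * 2 ^ k := by
    calc (1:ℝ) < (50/49) ^ k := one_lt_pow₀ (by norm_num) hW0.ne'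
      _ = (5/7)^(2*k) * 2^k := by rw [pow_mul, ← mul_pow]; norm_num
      _ ≤ _ := by
        gcongr ?_ * _
        exact pow_le_pow_of_le_one (by norm_num) (by norm_num) hW
  nlinarith

theorem dr_vectors {E : Type*} [NormedAddCommGroup E] [NormedSpace ℝ E]
    (hE : ¬ FiniteDimensional ℝ E) (k : ℕ) :
    ∃ x : Fin k → E, (∀ j, 2 / 5 ≤ ‖x j‖) ∧
      ∀ φ : E →L[ℝ] ℝ, ‖φ‖ ≤ 1 → ∑ j, (φ (x j)) ^ 2 ≤ 1 := by
  obtain ⟨U, hU, hW⟩ := dr_operator hE (2 * k)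
  have key : ∀ j ≤ k, ∃ v : Fin j → EuclideanSpace ℝ (Fin (2 * k)), Orthonormal ℝ v ∧
      ∀ i, 2 / 5 ≤ ‖U (v i)‖ := by
    intro j
    induction j with
    | zero => intro _; exact ⟨Fin.elim0, ⟨fun i => i.elim0, fun i => i.elim0⟩, fun i => i.elim0⟩
    | succ j ih =>
      intro hj
      obtain ⟨v, hv, hv2⟩ := ih (by omega)
      let W := (Submodule.span ℝ (Set.range v))ᗮ
      have hd : Module.finrank ℝ (Submodule.span ℝ (Set.range v)) + Module.finrank ℝ W = 2 * k := by
        rw [Submodule.finrank_add_finrank_orthogonal]; simp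
      have hd2 : Module.finrank ℝ (Submodule.span ℝ (Set.range v)) = j := by
        rw [finrank_span_eq_card hv.linearIndependent]; simp
      obtain ⟨w, hwW, hw1, hw2⟩ := hW W (by omega) (by omega)
      refine ⟨Matrix.vecCons w v, ?_, ?_⟩
      · rw [orthonormal_vecCons_iff]
        refine ⟨hw1, fun i => ?_, hv⟩
        rw [real_inner_comm]
        exact (Submodule.mem_orthogonal _ _).1 hwW _ (Submodule.subset_span ⟨i, rfl⟩)
      · intro i
        refine Fin.cases ?_ (fun i => ?_) i
        · simpa using hw2
        · simpa using hv2 i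
  obtain ⟨v, hv, hv2⟩ := key k le_rfl
  refine ⟨fun j => U (v j), hv2, fun φ hφ => ?_⟩
  let ψ := φ ∘L U
  have hψ : ‖ψ‖ ≤ 1 := (ContinuousLinearMap.opNorm_comp_le _ _).trans
    (mul_le_one₀ hφ (norm_nonneg _) hU)
  let z := (InnerProductSpace.toDual ℝ (EuclideanSpace ℝ (Fin (2 * k)))).symm ψ
  have hz : ∀ u, φ (U u) = inner ℝ z u := fun u => by
    simp [z, InnerProductSpace.toDual_symm_apply, ψ]
  have hzn : ‖z‖ ≤ 1 := by simpa [z] using hψ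
  have := hv.sum_inner_products_le z (s := Finset.univ)
  calc ∑ j, (φ (U (v j))) ^ 2 = ∑ j, ‖inner ℝ (v j) z‖ ^ 2 := by
        refine Finset.sum_congr rfl fun j _ => ?_
        rw [hz, real_inner_comm, Real.norm_eq_abs, sq_abs]
    _ ≤ ‖z‖ ^ 2 := this
    _ ≤ 1 := pow_le_one₀ (norm_nonneg _) hzn

open scoped BigOperators

/-- The real number attached to a sign. -/
noncomputable def sg (u : ℤˣ) : ℝ := ((u : ℤ) : ℝ)

theorem sg_one : sg 1 = 1 := by simp [sg]
theorem sg_neg (u : ℤˣ) : sg (-u) = - sg u := by simp [sg]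
theorem sg_mul (u v : ℤˣ) : sg (u * v) = sg u * sg v := by simp [sg]
theorem sg_sq (u : ℤˣ) : sg u ^ 2 = 1 := by
  rcases Int.units_eq_one_or u with h | h <;> simp [h, sg]
theorem sg_abs (u : ℤˣ) : |sg u| = 1 := by
  rcases Int.units_eq_one_or u with h | h <;> simp [h, sg]

theorem expect_cons (k : ℕ) (f : (Fin (k + 1) → ℤˣ) → ℝ) :
    𝔼 ε, f ε = 𝔼 ε : Fin k → ℤˣ, (f (Fin.cons 1 ε) + f (Fin.cons (-1) ε)) / 2 := by
  rw [← Fintype.expect_equiv (Fin.consEquiv fun _ : Fin (k + 1) => ℤˣ)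
    (fun q => f (Fin.cons q.1 q.2)) f (fun q => rfl)]
  rw [← Finset.univ_product_univ, Finset.expect_product, Finset.expect_comm]
  refine Finset.expect_congr rfl fun ε _ => ?_
  rw [Fintype.expect_eq_sum_div_card, UnitsInt.univ]
  simp

theorem measurable_rademacher (j : ℕ) : Measurable (rademacher j) := by
  unfold rademacher
  refine Measurable.ite ?_ measurable_const measurable_const
  exact measurableSet_lt (measurable_fract.comp (measurable_const.mul measurable_id)) measurable_const

theorem abs_rademacher_le (j : ℕ) (t : ℝ) : |rademacher j t| ≤ 1 := by
  unfold rademacher; split_ifs <;> simp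

theorem rademacher_succ (j : ℕ) (t : ℝ) : rademacher (j + 1) t = rademacher j (2 * t) := by
  unfold rademacher; rw [pow_succ, mul_assoc]

theorem rademacher_sub_one (j : ℕ) (t : ℝ) : rademacher j (t - 1) = rademacher j t := by
  unfold rademacher
  have : (2 : ℝ) ^ j * (t - 1) = 2 ^ j * t - ((2 ^ j : ℕ) : ℝ) := by push_cast; ring
  rw [this, Int.fract_sub_natCast]

theorem rad_intervalIntegrable (k : ℕ) (G : (Fin k → ℝ) → ℝ) (hG : Continuous G) (a b : ℝ) :
    IntervalIntegrable (fun t => G (fun j => rademacher j t)) volume a b := by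
  obtain ⟨B, hB⟩ := (isCompact_univ_pi (fun _ : Fin k => isCompact_Icc (a := (-1 : ℝ)) (b := 1))).exists_bound_of_continuousOn
    hG.continuousOn
  have hmeas : Measurable fun t => G (fun j : Fin k => rademacher j t) :=
    hG.measurable.comp (measurable_pi_lambda _ fun j => measurable_rademacher j)
  refine (intervalIntegrable_const (c := B)).mono_fun hmeas.aestronglyMeasurable ?_
  refine Filter.Eventually.of_forall fun t => ?_
  refine (hB _ ?_).trans (le_abs_self _)
  intro j _
  exact abs_le.1 (abs_rademacher_le j t)

theorem rad_integral (k : ℕ) : ∀ (G : (Fin k → ℝ) → ℝ), Continuous G →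
    ∫ t in (0:ℝ)..1, G (fun j => rademacher j t) = 𝔼 ε : Fin k → ℤˣ, G (fun j => sg (ε j)) := by
  induction k with
  | zero =>
    intro G _
    have h1 : ∀ t : ℝ, G (fun j : Fin 0 => rademacher j t) = G 0 := fun t => by
      congr 1; ext j; exact j.elim0
    have h2 : ∀ ε : Fin 0 → ℤˣ, G (fun j : Fin 0 => sg (ε j)) = G 0 := fun t => by
      congr 1; ext j; exact j.elim0
    simp [h1, h2]
  | succ k ih =>
    intro G hG
    rw [expect_cons, ← intervalIntegral.integral_add_adjacent_intervals
      (rad_intervalIntegrable _ G hG 0 (1/2)) (rad_intervalIntegrable _ G hG (1/2) 1)]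
    have hc : ∀ c : ℝ, Continuous fun v : Fin k → ℝ => G (Fin.cons c v) := fun c => by
      refine hG.comp ?_
      refine continuous_pi fun i => ?_
      refine Fin.cases ?_ (fun i => ?_) i
      · simpa using continuous_const
      · simpa using continuous_apply i
    have e1 : ∫ t in (0:ℝ)..(1/2), G (fun j => rademacher j t)
        = 1 / 2 * 𝔼 ε : Fin k → ℤˣ, G (Fin.cons 1 fun j => sg (ε j)) := by
      rw [← ih _ (hc 1)]
      have := intervalIntegral.integral_comp_mul_left (a := 0) (b := 1/2)
        (fun t => G (Fin.cons 1 fun j : Fin k => rademacher j t)) (two_ne_zero' ℝ)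
      norm_num at this
      rw [← this]
      apply intervalIntegral.integral_congr_Ioo_of_le (by norm_num)
      intro t ht
      dsimp only
      congr 1
      ext j
      refine Fin.cases ?_ (fun i => ?_) j
      · have : Int.fract t = t := Int.fract_eq_self.2 ⟨ht.1.le, by linarith [ht.2]⟩
        have h2 : t < 1 / 2 := by have := ht.2; norm_num at this ⊢; exact this
        simp only [rademacher, Fin.val_zero, pow_zero, one_mul, this, Fin.cons_zero]
        rw [if_pos h2]
      · simp [rademacher_succ]
    have e2 : ∫ t in (1/2:ℝ)..1, G (fun j => rademacher j t)
        = 1 / 2 * 𝔼 ε : Fin k → ℤˣ, G (Fin.cons (-1) fun j => sg (ε j)) := by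
      rw [← ih _ (hc (-1))]
      have := intervalIntegral.integral_comp_mul_sub (a := 1/2) (b := 1)
        (fun t => G (Fin.cons (-1) fun j : Fin k => rademacher j t)) (two_ne_zero' ℝ) 1
      norm_num at this
      rw [← this]
      apply intervalIntegral.integral_congr_Ioo_of_le (by norm_num)
      intro t ht
      dsimp only
      congr 1
      ext j
      refine Fin.cases ?_ (fun i => ?_) j
      · have : Int.fract t = t := Int.fract_eq_self.2 ⟨by linarith [ht.1], ht.2⟩
        have h2 : 1 / 2 ≤ t := by have := ht.1.le; norm_num at this ⊢; exact this
        simp only [rademacher, Fin.val_zero, pow_zero, one_mul, this, Fin.cons_zero]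
        rw [if_neg (not_lt.2 h2)]
      · simp [rademacher_succ, rademacher_sub_one]
    rw [e1, e2, ← mul_add, ← Finset.expect_add_distrib, Finset.mul_expect]
    refine Finset.expect_congr rfl fun ε _ => ?_
    have h : ∀ u : ℤˣ, (fun j => sg ((Fin.cons u ε : Fin (k+1) → ℤˣ) j))
        = (Fin.cons (sg u) fun j => sg (ε j) : Fin (k + 1) → ℝ) := fun u => by
      ext j; refine Fin.cases ?_ (fun i => ?_) j <;> simp
    rw [h, h, sg_neg, sg_one]
    ring

theorem radNorm_eq {F : Type*} [NormedAddCommGroup F] [NormedSpace ℝ F]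
    {k : ℕ} (y : Fin k → F) :
    radNorm y = (𝔼 ε : Fin k → ℤˣ, ‖∑ j, sg (ε j) • y j‖ ^ 2) ^ ((1:ℝ) / 2) := by
  unfold radNorm
  rw [← rad_integral k (fun v => ‖∑ j, v j • y j‖ ^ 2) (by fun_prop)]

theorem efron_stein (k : ℕ) : ∀ f : (Fin k → ℤˣ) → ℝ,
    𝔼 ε, f ε ^ 2 ≤ (𝔼 ε, f ε) ^ 2
      + (∑ i, 𝔼 ε, (f ε - f (Function.update ε i (-ε i))) ^ 2) / 4 := by
  induction k with
  | zero => intro f; simp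
  | succ k ih =>
    intro f
    let g : (Fin k → ℤˣ) → ℝ := fun ε => (f (Fin.cons 1 ε) + f (Fin.cons (-1) ε)) / 2
    have h := ih g
    rw [Fin.sum_univ_succ, expect_cons, expect_cons k f, expect_cons]
    change _ ≤ (𝔼 ε, g ε) ^ 2 + _
    have h0 : 𝔼 ε : Fin k → ℤˣ, (f (Fin.cons 1 ε) ^ 2 + f (Fin.cons (-1) ε) ^ 2) / 2
        = 𝔼 ε : Fin k → ℤˣ, g ε ^ 2
          + (𝔼 ε : Fin k → ℤˣ, (f (Fin.cons 1 ε) - f (Fin.cons (-1) ε)) ^ 2) / 4 := by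
      rw [Finset.expect_div, ← Finset.expect_add_distrib]
      refine Finset.expect_congr rfl fun ε _ => ?_
      simp only [g]; ring
    rw [h0]
    simp only [Fin.update_cons_zero, Fin.cons_zero, neg_neg]
    have h1 : ∑ i, 𝔼 ε, (g ε - g (Function.update ε i (-ε i))) ^ 2 ≤
        ∑ i : Fin k, 𝔼 ε, (f ε - f (Function.update ε i.succ (-ε i.succ))) ^ 2 := by
      refine Finset.sum_le_sum fun i _ => ?_
      rw [expect_cons]
      refine Finset.expect_le_expect fun ε _ => ?_
      simp only [g, Fin.cons_succ, ← Fin.cons_update]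
      nlinarith [sq_nonneg ((f (Fin.cons 1 ε) - f (Fin.cons 1 (Function.update ε i (-ε i)))) -
        (f (Fin.cons (-1) ε) - f (Fin.cons (-1) (Function.update ε i (-ε i)))))]
    have h2 : 𝔼 ε : Fin k → ℤˣ, ((f (Fin.cons 1 ε) - f (Fin.cons (-1) ε)) ^ 2
        + (f (Fin.cons (-1) ε) - f (Fin.cons 1 ε)) ^ 2) / 2
        = 𝔼 ε : Fin k → ℤˣ, (f (Fin.cons 1 ε) - f (Fin.cons (-1) ε)) ^ 2 := by
      refine Finset.expect_congr rfl fun ε _ => ?_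
      ring
    rw [h2]
    linarith

theorem variance_fin {E : Type*} [NormedAddCommGroup E] [NormedSpace ℝ E] (k : ℕ)
    (x : Fin k → E) (B : ℝ) (hB : ∀ φ : E →L[ℝ] ℝ, ‖φ‖ ≤ 1 → ∑ j, (φ (x j)) ^ 2 ≤ B) :
    𝔼 ε : Fin k → ℤˣ, ‖∑ j, sg (ε j) • x j‖ ^ 2
      ≤ (𝔼 ε : Fin k → ℤˣ, ‖∑ j, sg (ε j) • x j‖) ^ 2 + 2 * B := by
  let f : (Fin k → ℤˣ) → ℝ := fun ε => ‖∑ j, sg (ε j) • x j‖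
  let fl : Fin k → (Fin k → ℤˣ) → (Fin k → ℤˣ) := fun i ε => Function.update ε i (-ε i)
  have hfl : ∀ i, Function.Involutive (fl i) := fun i ε => by simp [fl]
  have hes := efron_stein k f
  have h1 : ∀ i, 𝔼 ε, (f ε - f (fl i ε)) ^ 2 = 2 * 𝔼 ε, (max (f ε - f (fl i ε)) 0) ^ 2 := by
    intro i
    have e1 : 𝔼 ε, (max (f (fl i ε) - f ε) 0) ^ 2 = 𝔼 ε, (max (f ε - f (fl i ε)) 0) ^ 2 := by
      refine Fintype.expect_equiv (hfl i).toPerm _ _ fun ε => ?_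
      simp [hfl i ε]
    rw [two_mul]
    nth_rewrite 2 [← e1]
    rw [← Finset.expect_add_distrib]
    refine Finset.expect_congr rfl fun ε _ => ?_
    rcases le_total (f ε) (f (fl i ε)) with h | h
    · rw [max_eq_right (by linarith), max_eq_left (by linarith)]; ring
    · rw [max_eq_left (by linarith), max_eq_right (by linarith)]; ring
  have h2 : ∀ ε, ∑ i, (max (f ε - f (fl i ε)) 0) ^ 2 ≤ 4 * B := by
    intro ε
    obtain ⟨φ, hφ, hφx⟩ := exists_dual_vector'' ℝ (∑ j, sg (ε j) • x j)
    have h3 : ∀ i, (max (f ε - f (fl i ε)) 0) ^ 2 ≤ 4 * (φ (x i)) ^ 2 := by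
      intro i
      have hv : ∑ j, sg (fl i ε j) • x j = ∑ j, sg (ε j) • x j - (2 * sg (ε i)) • x i := by
        rw [eq_sub_iff_add_eq, ← Finset.add_sum_erase _ _ (Finset.mem_univ i),
          ← Finset.add_sum_erase (a := i) _ (fun j => sg (ε j) • x j) (Finset.mem_univ i)]
        have : ∑ j ∈ Finset.univ.erase i, sg (fl i ε j) • x j
            = ∑ j ∈ Finset.univ.erase i, sg (ε j) • x j := by
          refine Finset.sum_congr rfl fun j hj => ?_
          simp [fl, Function.update_of_ne (Finset.ne_of_mem_erase hj)]
        rw [this]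
        simp only [fl, Function.update_self, sg_neg]
        module
      have h4 : φ (∑ j, sg (fl i ε j) • x j) ≤ f (fl i ε) :=
        (le_abs_self _).trans ((φ.le_of_opNorm_le hφ _).trans (by simp [f]))
      have h5 : φ (∑ j, sg (ε j) • x j) = f ε := by simpa [f] using hφx
      rw [hv, map_sub, h5, map_smul, smul_eq_mul] at h4
      have h6 : f ε - f (fl i ε) ≤ 2 * |φ (x i)| := by
        have : 2 * sg (ε i) * φ (x i) ≤ 2 * |φ (x i)| := by
          refine (le_abs_self _).trans ?_
          rw [abs_mul, abs_mul, sg_abs]; simp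
        linarith
      calc (max (f ε - f (fl i ε)) 0) ^ 2 ≤ (2 * |φ (x i)|) ^ 2 := by
            gcongr
            exact max_le h6 (by positivity)
        _ = _ := by rw [mul_pow, sq_abs]; norm_num
    calc _ ≤ ∑ i, 4 * (φ (x i)) ^ 2 := Finset.sum_le_sum fun i _ => h3 i
      _ = 4 * ∑ i, (φ (x i)) ^ 2 := by rw [Finset.mul_sum]
      _ ≤ _ := by linarith [hB φ hφ]
  have h3 : ∑ i, 𝔼 ε, (f ε - f (fl i ε)) ^ 2 ≤ 8 * B := by
    calc ∑ i, 𝔼 ε, (f ε - f (fl i ε)) ^ 2 = 2 * 𝔼 ε, ∑ i, (max (f ε - f (fl i ε)) 0) ^ 2 := by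
          rw [Finset.expect_sum_comm, Finset.mul_sum]
          exact Finset.sum_congr rfl fun i _ => h1 i
      _ ≤ 2 * (4 * B) := by
          gcongr
          exact Finset.expect_le Finset.univ_nonempty fun ε _ => h2 ε
      _ = _ := by ring
  change _ ≤ (𝔼 ε, f ε) ^ 2 + _
  linarith

theorem variance_gen {E : Type*} [NormedAddCommGroup E] [NormedSpace ℝ E] {ι : Type*} [Fintype ι]
    [DecidableEq ι] (x : ι → E) (B : ℝ)
    (hB : ∀ φ : E →L[ℝ] ℝ, ‖φ‖ ≤ 1 → ∑ j, (φ (x j)) ^ 2 ≤ B) :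
    𝔼 ε : ι → ℤˣ, ‖∑ j, sg (ε j) • x j‖ ^ 2
      ≤ (𝔼 ε : ι → ℤˣ, ‖∑ j, sg (ε j) • x j‖) ^ 2 + 2 * B := by
  let e := Fintype.equivFin ι
  have h := variance_fin _ (fun i => x (e.symm i)) B (fun φ hφ => by
    rw [Equiv.sum_comp e.symm (fun j => (φ (x j)) ^ 2)]; exact hB φ hφ)
  have hs : ∀ ε : ι → ℤˣ, ∑ j, sg (ε j) • x j
      = ∑ i, sg ((Equiv.arrowCongr e (Equiv.refl ℤˣ)) ε i) • x (e.symm i) := fun ε => by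
    rw [← Equiv.sum_comp e.symm]; rfl
  rw [Fintype.expect_equiv (Equiv.arrowCongr e (Equiv.refl ℤˣ)) _
      (fun ε => ‖∑ i, sg (ε i) • x (e.symm i)‖ ^ 2) (fun ε => by rw [hs]),
    Fintype.expect_equiv (Equiv.arrowCongr e (Equiv.refl ℤˣ)) _
      (fun ε => ‖∑ i, sg (ε i) • x (e.symm i)‖) (fun ε => by rw [hs])]
  exact h

/-- Variance bound in deviation form for a two-index family. -/
theorem variance_two {E : Type*} [NormedAddCommGroup E] [NormedSpace ℝ E] {ι κ : Type*} [Fintype ι]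
    [DecidableEq ι] [Fintype κ] [DecidableEq κ] (x : ι → E) (c : κ → ℝ)
    (hB : ∀ φ : E →L[ℝ] ℝ, ‖φ‖ ≤ 1 → ∑ j, (φ (x j)) ^ 2 ≤ 1) :
    𝔼 h : ι → κ → ℤˣ, (‖∑ j, (∑ i, sg (h j i) * c i) • x j‖
      - 𝔼 h : ι → κ → ℤˣ, ‖∑ j, (∑ i, sg (h j i) * c i) • x j‖) ^ 2 ≤ 2 * ∑ i, c i ^ 2 := by
  set μ := 𝔼 h : ι → κ → ℤˣ, ‖∑ j, (∑ i, sg (h j i) * c i) • x j‖ with hμ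
  have hv := variance_gen (fun q : ι × κ => c q.2 • x q.1) (∑ i, c i ^ 2) (fun φ hφ => by
    rw [Fintype.sum_prod_type]
    calc ∑ j, ∑ i, (φ (c i • x j)) ^ 2 = (∑ i, c i ^ 2) * ∑ j, (φ (x j)) ^ 2 := by
          rw [Finset.sum_mul_sum, Finset.sum_comm]
          simp [mul_pow]
      _ ≤ (∑ i, c i ^ 2) * 1 := mul_le_mul_of_nonneg_left (hB φ hφ)
          (Finset.sum_nonneg fun i _ => sq_nonneg _)
      _ = _ := mul_one _)
  have hs : ∀ ε : ι × κ → ℤˣ, ∑ q : ι × κ, sg (ε q) • c q.2 • x q.1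
      = ∑ j, (∑ i, sg (Equiv.curry ι κ ℤˣ ε j i) * c i) • x j := fun ε => by
    rw [Fintype.sum_prod_type]
    refine Finset.sum_congr rfl fun j _ => ?_
    rw [Finset.sum_smul]
    refine Finset.sum_congr rfl fun i _ => ?_
    rw [smul_smul]; rfl
  rw [Fintype.expect_equiv (Equiv.curry ι κ ℤˣ) _
      (fun h => ‖∑ j, (∑ i, sg (h j i) * c i) • x j‖ ^ 2) (fun ε => by rw [hs]),
    Fintype.expect_equiv (Equiv.curry ι κ ℤˣ) _
      (fun h => ‖∑ j, (∑ i, sg (h j i) * c i) • x j‖) (fun ε => by rw [hs]), ← hμ] at hv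
  have he : 𝔼 h : ι → κ → ℤˣ, (‖∑ j, (∑ i, sg (h j i) * c i) • x j‖ - μ) ^ 2
      = 𝔼 h : ι → κ → ℤˣ, ‖∑ j, (∑ i, sg (h j i) * c i) • x j‖ ^ 2 - μ ^ 2 := by
    have : ∀ h : ι → κ → ℤˣ, (‖∑ j, (∑ i, sg (h j i) * c i) • x j‖ - μ) ^ 2
        = ‖∑ j, (∑ i, sg (h j i) * c i) • x j‖ ^ 2 -
          2 * μ * ‖∑ j, (∑ i, sg (h j i) * c i) • x j‖ + μ ^ 2 := fun h => by ring
    simp_rw [this]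
    rw [Finset.expect_add_distrib, Finset.expect_sub_distrib, ← Finset.mul_expect, ← hμ,
      Fintype.expect_const]
    ring
  rw [he]; linarith

theorem expect_eval {ι A : Type*} [Fintype ι] [DecidableEq ι] [Fintype A] [Nonempty A] (j : ι)
    (f : A → ℝ) : 𝔼 h : ι → A, f (h j) = 𝔼 a, f a := by
  rw [Fintype.expect_equiv (Equiv.funSplitAt j A) (fun h => f (h j)) (fun q => f q.1)
    (fun h => rfl), ← Finset.univ_product_univ, Finset.expect_product]
  refine Finset.expect_congr rfl fun a _ => ?_
  dsimp only
  rw [Fintype.expect_const]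

/-- The sum of signs. -/
noncomputable def ssum {κ : Type*} [Fintype κ] (g : κ → ℤˣ) : ℝ := ∑ i, sg (g i)

theorem symm_expect {E : Type*} [NormedAddCommGroup E] [NormedSpace ℝ E] {ι κ : Type*} [Fintype ι]
    [DecidableEq ι] [Fintype κ] [DecidableEq κ] (x : ι → E) :
    𝔼 h : ι → κ → ℤˣ, ‖∑ j, ssum (h j) • x j‖
      = 𝔼 h : ι → κ → ℤˣ, 𝔼 η : ι → ℤˣ, ‖∑ j, sg (η j) • |ssum (h j)| • x j‖ := by
  have h1 : ∀ η : ι → ℤˣ, 𝔼 h : ι → κ → ℤˣ, ‖∑ j, ssum (h j) • x j‖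
      = 𝔼 h : ι → κ → ℤˣ, ‖∑ j, sg (η j) • ssum (h j) • x j‖ := by
    intro η
    symm
    refine Fintype.expect_equiv (Equiv.mulLeft (fun j _ => η j : ι → κ → ℤˣ)) _ _ fun h => ?_
    congr 1
    refine Finset.sum_congr rfl fun j _ => ?_
    simp [ssum, sg_mul, smul_smul, Finset.mul_sum]
  have h2 : 𝔼 h : ι → κ → ℤˣ, ‖∑ j, ssum (h j) • x j‖
      = 𝔼 η : ι → ℤˣ, 𝔼 h : ι → κ → ℤˣ, ‖∑ j, sg (η j) • ssum (h j) • x j‖ := by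
    rw [← Fintype.expect_const (ι := ι → ℤˣ) (𝔼 h : ι → κ → ℤˣ, ‖∑ j, ssum (h j) • x j‖)]
    exact Finset.expect_congr rfl fun η _ => h1 η
  rw [h2, Finset.expect_comm]
  refine Finset.expect_congr rfl fun h _ => ?_
  have hσ : ∀ j, ∃ u : ℤˣ, ssum (h j) = sg u * |ssum (h j)| := fun j => by
    rcases le_total 0 (ssum (h j)) with h | h
    · exact ⟨1, by rw [abs_of_nonneg h, sg_one, one_mul]⟩
    · exact ⟨-1, by rw [abs_of_nonpos h, sg_neg, sg_one]; ring⟩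
  choose σ hσ using hσ
  refine Fintype.expect_equiv (Equiv.mulRight σ) _ _ fun η => ?_
  congr 1
  refine Finset.sum_congr rfl fun j _ => ?_
  nth_rewrite 1 [hσ j]
  simp [sg_mul, smul_smul, mul_assoc]

theorem expect_ge_one {E : Type*} [NormedAddCommGroup E] [NormedSpace ℝ E] {ι : Type*} [Fintype ι]
    [DecidableEq ι] (y : ι → E) (k : ι) :
    ‖y k‖ ≤ 𝔼 η : ι → ℤˣ, ‖∑ j, sg (η j) • y j‖ := by
  let τ : ι → ℤˣ := fun j => if j = k then 1 else -1
  have h1 : 𝔼 η : ι → ℤˣ, ‖∑ j, sg (η j) • y j‖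
      = 𝔼 η : ι → ℤˣ, ‖∑ j, sg (τ j * η j) • y j‖ := by
    symm
    exact Fintype.expect_equiv (Equiv.mulLeft τ) _ _ fun η => rfl
  have h2 : 𝔼 η : ι → ℤˣ, ‖∑ j, sg (η j) • y j‖ = 𝔼 η : ι → ℤˣ,
      (‖∑ j, sg (η j) • y j‖ + ‖∑ j, sg (τ j * η j) • y j‖) / 2 := by
    rw [← Finset.expect_div, Finset.expect_add_distrib, ← h1]; ring
  rw [h2]
  refine Finset.le_expect Finset.univ_nonempty fun η _ => ?_
  have h3 : ∑ j, sg (η j) • y j + ∑ j, sg (τ j * η j) • y j = (2 * sg (η k)) • y k := by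
    rw [← Finset.sum_add_distrib, Finset.sum_eq_single k]
    · simp only [τ, if_true, one_mul]; module
    · intro j _ hj
      simp only [τ, if_neg hj, sg_mul, sg_neg, sg_one]; module
    · simp
  have h4 := norm_add_le (∑ j, sg (η j) • y j) (∑ j, sg (τ j * η j) • y j)
  rw [h3, norm_smul, Real.norm_eq_abs, abs_mul, sg_abs] at h4
  norm_num at h4
  linarith

theorem ssum_sq (n : ℕ) : 𝔼 g : Fin n → ℤˣ, ssum g ^ 2 = n := by
  induction n with
  | zero => simp [ssum]
  | succ n ih =>
    rw [expect_cons]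
    have : ∀ g : Fin n → ℤˣ, (ssum (Fin.cons 1 g : Fin (n + 1) → ℤˣ) ^ 2 +
        ssum (Fin.cons (-1) g : Fin (n + 1) → ℤˣ) ^ 2) / 2 = ssum g ^ 2 + 1 := fun g => by
      simp only [ssum, Fin.sum_univ_succ, Fin.cons_zero, Fin.cons_succ, sg_neg, sg_one]; ring
    simp_rw [this]
    rw [Finset.expect_add_distrib, ih, Fintype.expect_const]; push_cast; ring

theorem ssum_four (n : ℕ) : 𝔼 g : Fin n → ℤˣ, ssum g ^ 4 ≤ 3 * n ^ 2 := by
  induction n with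
  | zero => simp [ssum]
  | succ n ih =>
    rw [expect_cons]
    have : ∀ g : Fin n → ℤˣ, (ssum (Fin.cons 1 g : Fin (n + 1) → ℤˣ) ^ 4 +
        ssum (Fin.cons (-1) g : Fin (n + 1) → ℤˣ) ^ 4) / 2
          = ssum g ^ 4 + 6 * ssum g ^ 2 + 1 := fun g => by
      simp only [ssum, Fin.sum_univ_succ, Fin.cons_zero, Fin.cons_succ, sg_neg, sg_one]; ring
    simp_rw [this]
    rw [Finset.expect_add_distrib, Finset.expect_add_distrib, ← Finset.mul_expect, ssum_sq,
      Fintype.expect_const]; push_cast; nlinarith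

theorem ssum_abs (N : ℕ) (hN : 0 < N) : 2 / 5 * (N : ℝ) ≤ 𝔼 g : Fin (N ^ 2) → ℤˣ, |ssum g| := by
  have hN' : (0:ℝ) < N := by exact_mod_cast hN
  have hp : ∀ s : ℝ, s ^ 2 / N - s ^ 4 / (5 * N ^ 3) ≤ |s| := by
    intro s
    obtain ⟨v, hv0, hv⟩ : ∃ v : ℝ, 0 ≤ v ∧ |s| = N * v :=
      ⟨|s| / N, by positivity, by field_simp⟩
    have e2 : s ^ 2 = (N * v) ^ 2 := by rw [← hv, sq_abs]
    have e4 : s ^ 4 = (N * v) ^ 4 := by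
      rw [show (4:ℕ) = 2 * 2 by norm_num, pow_mul, pow_mul, e2]
    rw [hv, e2, e4]
    have : (N * v) ^ 2 / N - (N * v) ^ 4 / (5 * N ^ 3) = N * (v * (v - v ^ 3 / 5)) := by
      field_simp
    rw [this]
    have h3 : v - v ^ 3 / 5 ≤ 1 := by
      nlinarith [mul_nonneg (sq_nonneg (v - 13/10)) (by linarith : (0:ℝ) ≤ v + 13/5)]
    have := mul_le_mul_of_nonneg_left h3 hv0
    rw [mul_one] at this
    exact mul_le_mul_of_nonneg_left this hN'.le
  have h1 : 𝔼 g : Fin (N ^ 2) → ℤˣ, (ssum g ^ 2 / N - ssum g ^ 4 / (5 * N ^ 3))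
      ≤ 𝔼 g : Fin (N ^ 2) → ℤˣ, |ssum g| := Finset.expect_le_expect fun g _ => hp _
  rw [Finset.expect_sub_distrib, ← Finset.expect_div, ← Finset.expect_div, ssum_sq] at h1
  refine le_trans ?_ h1
  have h4 := ssum_four (N ^ 2)
  have h5 : (𝔼 g : Fin (N ^ 2) → ℤˣ, ssum g ^ 4) / (5 * N ^ 3) ≤ 3 / 5 * N := by
    rw [div_le_iff₀ (by positivity)]
    push_cast at h4
    refine h4.trans (le_of_eq ?_)
    ring
  have h6 : ((N ^ 2 : ℕ) : ℝ) / N = N := by push_cast; field_simp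
  rw [h6]; linarith

/-- `E ‖∑ S_j x_j‖ ≥ (E|S|) E ‖∑ r_j x_j‖`. -/
theorem mu_ge {E : Type*} [NormedAddCommGroup E] [NormedSpace ℝ E] {ι κ : Type*} [Fintype ι]
    [DecidableEq ι] [Fintype κ] [DecidableEq κ] (x : ι → E) :
    (𝔼 g : κ → ℤˣ, |ssum g|) * 𝔼 η : ι → ℤˣ, ‖∑ j, sg (η j) • x j‖
      ≤ 𝔼 h : ι → κ → ℤˣ, ‖∑ j, ssum (h j) • x j‖ := by
  set m := 𝔼 g : κ → ℤˣ, |ssum g| with hm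
  have hm0 : 0 ≤ m := Finset.expect_nonneg fun _ _ => abs_nonneg _
  rw [symm_expect, Finset.expect_comm, Finset.mul_expect]
  refine Finset.expect_le_expect fun η _ => ?_
  obtain ⟨φ, hφ, hφx⟩ := exists_dual_vector'' ℝ (∑ j, sg (η j) • x j)
  have hφx' : ∑ j, sg (η j) * φ (x j) = ‖∑ j, sg (η j) • x j‖ := by
    have : φ (∑ j, sg (η j) • x j) = ‖∑ j, sg (η j) • x j‖ := by simpa using hφx
    rw [← this, map_sum]
    simp
  calc m * ‖∑ j, sg (η j) • x j‖
      = 𝔼 h : ι → κ → ℤˣ, ∑ j, |ssum (h j)| * (sg (η j) * φ (x j)) := by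
        rw [← hφx', Finset.expect_sum_comm, Finset.mul_sum]
        refine Finset.sum_congr rfl fun j _ => ?_
        rw [← Finset.expect_mul, expect_eval j (fun g : κ → ℤˣ => |ssum g|)]
    _ ≤ _ := by
        refine Finset.expect_le_expect fun h _ => ?_
        have h2 : φ (∑ j, sg (η j) • |ssum (h j)| • x j)
            = ∑ j, |ssum (h j)| * (sg (η j) * φ (x j)) := by
          rw [map_sum]
          refine Finset.sum_congr rfl fun j _ => ?_
          simp only [map_smul, smul_eq_mul]
          ring
        rw [← h2]
        exact (le_abs_self _).trans ((φ.le_of_opNorm_le hφ _).trans (by simp))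

theorem base_family {E : Type*} [NormedAddCommGroup E] [NormedSpace ℝ E]
    (hE : ¬ FiniteDimensional ℝ E) (T : ℝ) :
    ∃ (N m : ℕ) (x : Fin N × Fin m → E),
      (∀ φ : E →L[ℝ] ℝ, ‖φ‖ ≤ 1 → ∑ j, (φ (x j)) ^ 2 ≤ 1) ∧
      T ≤ 𝔼 ε : Fin N × Fin m → ℤˣ, ‖∑ j, sg (ε j) • x j‖ := by
  classical
  obtain ⟨q, hq⟩ := exists_nat_ge (max (5 * T) 1)
  have hq1 : (1:ℝ) ≤ q := (le_max_right _ _).trans hq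
  have hqT : 5 * T ≤ q := (le_max_left _ _).trans hq
  have hq0 : (0:ℝ) < q := by linarith
  let f : (Fin (q ^ 2) → ℤˣ) → ℝ := fun g => if g = 1 then 0 else 1
  have hf0 : 0 ≤ 𝔼 g, f g := Finset.expect_nonneg fun g _ => by simp only [f]; split_ifs <;> simp
  have hf1 : 𝔼 g, f g < 1 := by
    refine Finset.expect_lt (fun g _ => ?_) ⟨1, Finset.mem_univ _, by simp [f]⟩
    simp only [f]; split_ifs <;> simp
  obtain ⟨N, hN⟩ := exists_pow_lt_of_lt_one (show (0:ℝ) < 1 / 2 by norm_num) hf1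
  rw [Finset.expect_pow, Fintype.piFinset_univ] at hN
  obtain ⟨z, hz, hzw⟩ := dr_vectors hE N
  refine ⟨N, q ^ 2, fun j => (q : ℝ)⁻¹ • z j.1, fun φ hφ => ?_, ?_⟩
  · rw [Fintype.sum_prod_type]
    refine le_trans (le_of_eq ?_) (hzw φ hφ)
    refine Finset.sum_congr rfl fun j _ => ?_
    simp
    field_simp
  · have hs : ∀ ε : Fin N × Fin (q ^ 2) → ℤˣ, ‖∑ j, sg (ε j) • (q : ℝ)⁻¹ • z j.1‖
        = (q : ℝ)⁻¹ * ‖∑ j, ssum (Equiv.curry _ _ ℤˣ ε j) • z j‖ := fun ε => by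
      rw [Fintype.sum_prod_type, ← abs_of_nonneg (inv_nonneg.2 hq0.le), ← Real.norm_eq_abs,
        ← norm_smul, Real.norm_of_nonneg (inv_nonneg.2 hq0.le), Finset.smul_sum]
      congr 1
      refine Finset.sum_congr rfl fun j _ => ?_
      rw [ssum, Finset.sum_smul, Finset.smul_sum]
      refine Finset.sum_congr rfl fun i _ => ?_
      rw [smul_comm]; rfl
    rw [Fintype.expect_equiv (Equiv.curry _ _ ℤˣ) _
      (fun h => (q : ℝ)⁻¹ * ‖∑ j, ssum (h j) • z j‖) hs, ← Finset.mul_expect, symm_expect]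
    have key : (2 / 5 * (q:ℝ) ^ 2) * (1 / 2) ≤
        𝔼 h : Fin N → Fin (q ^ 2) → ℤˣ, 𝔼 η : Fin N → ℤˣ,
          ‖∑ j, sg (η j) • |ssum (h j)| • z j‖ := by
      calc (2 / 5 * (q:ℝ) ^ 2) * (1 / 2)
          ≤ (2 / 5 * (q:ℝ) ^ 2) * (1 - 𝔼 h : Fin N → Fin (q ^ 2) → ℤˣ, ∏ j, f (h j)) := by
            gcongr; linarith
        _ = 𝔼 h : Fin N → Fin (q ^ 2) → ℤˣ, (2 / 5 * (q:ℝ) ^ 2) * (1 - ∏ j, f (h j)) := by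
            rw [← Finset.mul_expect, Finset.expect_sub_distrib, Fintype.expect_const]
        _ ≤ _ := by
            refine Finset.expect_le_expect fun h _ => ?_
            by_cases hh : ∃ j, h j = 1
            · obtain ⟨j, hj⟩ := hh
              have := expect_ge_one (fun j => |ssum (h j)| • z j) j
              refine le_trans ?_ this
              rw [Finset.prod_eq_zero (Finset.mem_univ j) (by simp [f, hj]), hj, norm_smul]
              have : ssum (1 : Fin (q ^ 2) → ℤˣ) = (q:ℝ) ^ 2 := by simp [ssum, sg_one]
              rw [this, Real.norm_eq_abs, abs_abs, abs_of_nonneg (by positivity)]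
              nlinarith [hz j, sq_nonneg (q:ℝ)]
            · push Not at hh
              have : ∏ j, f (h j) = 1 := Finset.prod_eq_one fun j _ => by simp [f, hh j]
              rw [this]
              simp only [sub_self, mul_zero]
              exact Finset.expect_nonneg fun _ _ => norm_nonneg _
    have := mul_le_mul_of_nonneg_left key (inv_nonneg.2 hq0.le)
    refine le_trans ?_ this
    have : (q:ℝ)⁻¹ * ((2 / 5 * (q:ℝ) ^ 2) * (1 / 2)) = q / 5 := by field_simp
    rw [this]; linarith

theorem weakNorm_nonneg {E : Type*} [NormedAddCommGroup E] [NormedSpace ℝ E]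
    (q : ℝ) {k : ℕ} (x : Fin k → E) : 0 ≤ weakNorm q x := by
  refine Real.sSup_nonneg ?_
  rintro s ⟨φ, _, rfl⟩
  exact Real.rpow_nonneg (Finset.sum_nonneg fun j _ => Real.rpow_nonneg (abs_nonneg _) _) _

theorem weakNorm_le {E : Type*} [NormedAddCommGroup E] [NormedSpace ℝ E]
    (p : ℝ) (hp : 1 < p) {k : ℕ} (y : Fin k → E) (a b : ℝ) (ha0 : 0 < a) (ha : ∀ i, ‖y i‖ ≤ a)
    (hb : ∀ ε : Fin k → ℤˣ, ‖∑ i, sg (ε i) • y i‖ ≤ b) :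
    weakNorm p y ≤ (a ^ (p - 1) * b) ^ (1 / p) := by
  refine csSup_le ⟨_, 0, by simp, rfl⟩ ?_
  rintro s ⟨φ, hφ, rfl⟩
  have hnn : 0 ≤ ∑ j, |φ (y j)| ^ p :=
    Finset.sum_nonneg fun j _ => Real.rpow_nonneg (abs_nonneg _) _
  refine Real.rpow_le_rpow hnn ?_ (by positivity)
  have h1 : ∀ j, |φ (y j)| ^ p ≤ a ^ (p - 1) * |φ (y j)| := by
    intro j
    have h2 : |φ (y j)| ≤ a := ((φ.le_of_opNorm_le hφ _).trans (by simp)).trans (ha j)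
    calc |φ (y j)| ^ p = |φ (y j)| ^ ((p - 1) + 1) := by ring_nf
      _ = |φ (y j)| ^ (p - 1) * |φ (y j)| := by
          rw [Real.rpow_add_one' (abs_nonneg _) (by linarith)]
      _ ≤ _ := by
          gcongr
  refine (Finset.sum_le_sum fun j _ => h1 j).trans ?_
  rw [← Finset.mul_sum]
  gcongr
  have hσ : ∀ j, ∃ u : ℤˣ, |φ (y j)| = sg u * φ (y j) := fun j => by
    rcases le_total 0 (φ (y j)) with h | h
    · exact ⟨1, by rw [abs_of_nonneg h, sg_one, one_mul]⟩
    · exact ⟨-1, by rw [abs_of_nonpos h, sg_neg, sg_one]; ring⟩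
  choose σ hσ using hσ
  calc ∑ j, |φ (y j)| = φ (∑ j, sg (σ j) • y j) := by
        rw [map_sum]
        exact Finset.sum_congr rfl fun j _ => by rw [hσ j]; simp
    _ ≤ |φ (∑ j, sg (σ j) • y j)| := le_abs_self _
    _ ≤ 1 * ‖∑ j, sg (σ j) • y j‖ := φ.le_of_opNorm_le hφ _
    _ ≤ b := by rw [one_mul]; exact hb σ

/-- For every `N` there is a family with controlled sign sums. -/
theorem good_family {E : Type*} [NormedAddCommGroup E] [NormedSpace ℝ E]
    (hE : ¬ FiniteDimensional ℝ E) (N : ℕ) (hN : 3 ≤ N) :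
    ∃ (y : Fin (N ^ 2) → E) (R μ : ℝ), 0 < R ∧ 2 / 5 * N * R ≤ μ ∧ (∀ i, ‖y i‖ ≤ 2 * R) ∧
      ∀ ε : Fin (N ^ 2) → ℤˣ, μ / 2 ≤ ‖∑ i, sg (ε i) • y i‖ ∧ ‖∑ i, sg (ε i) • y i‖ ≤ 2 * μ := by
  set n := N ^ 2 with hn
  let D : ℝ := ∑ ε : Fin n → ℤˣ, 2 * ∑ i, sg (ε i) ^ 2
    + ∑ k : Fin n, 2 * ∑ i, (Pi.single k (1:ℝ) : Fin n → ℝ) i ^ 2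
  have hD0 : 0 ≤ D := by positivity
  obtain ⟨N', m', x, hx, hT⟩ := base_family hE (2 * D + 2)
  set R := 𝔼 ε : Fin N' × Fin m' → ℤˣ, ‖∑ j, sg (ε j) • x j‖ with hR
  have hR0 : 0 < R := by linarith
  set μ := 𝔼 h : Fin N' × Fin m' → Fin n → ℤˣ, ‖∑ j, ssum (h j) • x j‖ with hμ
  have hNr : (3:ℝ) ≤ N := by exact_mod_cast hN
  have hμR : 2 / 5 * N * R ≤ μ :=
    (mul_le_mul_of_nonneg_right (ssum_abs N (by omega)) hR0.le).trans (mu_ge x)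
  let Z : (Fin n → ℝ) → (Fin N' × Fin m' → Fin n → ℤˣ) → ℝ :=
    fun c h => ‖∑ j, (∑ i, sg (h j i) * c i) • x j‖
  have hZ : ∀ c h, Z c h = ‖∑ i, c i • ∑ j, sg (h j i) • x j‖ := by
    intro c h
    simp only [Z]
    congr 1
    simp_rw [Finset.sum_smul, Finset.smul_sum]
    rw [Finset.sum_comm]
    refine Finset.sum_congr rfl fun i _ => Finset.sum_congr rfl fun j _ => ?_
    rw [smul_smul, mul_comm]
  have hm1 : ∀ ε : Fin n → ℤˣ, 𝔼 h, Z (fun i => sg (ε i)) h = μ := by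
    intro ε
    refine Fintype.expect_equiv
      (Equiv.mulLeft (fun _ i => ε i : Fin N' × Fin m' → Fin n → ℤˣ)) _ _ fun h => ?_
    simp [Z, ssum, sg_mul, mul_comm]
  have hm2 : ∀ k : Fin n, 𝔼 h, Z (Pi.single k 1) h = R := by
    intro k
    have h1 : ∀ h, Z (Pi.single k 1) h = ‖∑ j, sg (h j k) • x j‖ := fun h => by
      simp [Z, Pi.single_apply]
    simp_rw [h1]
    rw [hR, ← expect_eval k (fun η : Fin N' × Fin m' → ℤˣ => ‖∑ j, sg (η j) • x j‖)]
    exact Fintype.expect_equiv (Equiv.piComm _) _ _ fun h => rfl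
  have hv : 𝔼 h, (∑ ε : Fin n → ℤˣ, (Z (fun i => sg (ε i)) h - μ) ^ 2
      + ∑ k : Fin n, (Z (Pi.single k 1) h - R) ^ 2) ≤ D := by
    rw [Finset.expect_add_distrib, Finset.expect_sum_comm, Finset.expect_sum_comm]
    refine add_le_add (Finset.sum_le_sum fun ε _ => ?_) (Finset.sum_le_sum fun k _ => ?_)
    · have := variance_two x (fun i => sg (ε i)) hx
      change 𝔼 h, (Z (fun i => sg (ε i)) h - 𝔼 h, Z (fun i => sg (ε i)) h) ^ 2 ≤ _ at this
      rwa [hm1] at this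
    · have := variance_two x (Pi.single k (1:ℝ) : Fin n → ℝ) hx
      change 𝔼 h, (Z (Pi.single k 1) h - 𝔼 h, Z (Pi.single k 1) h) ^ 2 ≤ _ at this
      rwa [hm2] at this
  obtain ⟨h, -, hh⟩ := Finset.exists_le_of_expect_le Finset.univ_nonempty hv
  have n1 : 0 ≤ ∑ ε : Fin n → ℤˣ, (Z (fun i => sg (ε i)) h - μ) ^ 2 :=
    Finset.sum_nonneg fun _ _ => sq_nonneg _
  have n2 : 0 ≤ ∑ k : Fin n, (Z (Pi.single k 1) h - R) ^ 2 :=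
    Finset.sum_nonneg fun _ _ => sq_nonneg _
  have hDR : D ≤ (R / 2) ^ 2 := by nlinarith
  refine ⟨fun i => ∑ j, sg (h j i) • x j, R, μ, hR0, hμR, fun k => ?_, fun ε => ?_⟩
  · have h1 : (Z (Pi.single k 1) h - R) ^ 2 ≤ (R / 2) ^ 2 := by
      have := Finset.single_le_sum (f := fun k : Fin n => (Z (Pi.single k 1) h - R) ^ 2)
        (fun _ _ => sq_nonneg _) (Finset.mem_univ k)
      linarith
    have h2 := abs_le_of_sq_le_sq' h1 (by linarith)
    have h3 : Z (Pi.single k 1) h = ‖∑ j, sg (h j k) • x j‖ := by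
      simp [Z, Pi.single_apply]
    rw [← h3]; linarith [h2.2]
  · have h1 : (Z (fun i => sg (ε i)) h - μ) ^ 2 ≤ (R / 2) ^ 2 := by
      have := Finset.single_le_sum
        (f := fun ε : Fin n → ℤˣ => (Z (fun i => sg (ε i)) h - μ) ^ 2)
        (fun _ _ => sq_nonneg _) (Finset.mem_univ ε)
      linarith
    have h2 := abs_le_of_sq_le_sq' h1 (by linarith)
    have h3 : R ≤ μ := by nlinarith
    rw [hZ] at h2
    constructor <;> linarith [h2.1, h2.2]

theorem stmt18 {E : Type*} [NormedAddCommGroup E] [NormedSpace ℝ E] [CompleteSpace E]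
    (hE : ¬ FiniteDimensional ℝ E) (p : ℝ) (hp : 1 < p) :
    ¬ ∃ C : ℝ, ∀ (k : ℕ) (x : Fin k → E), radNorm x ≤ C * weakNorm p x := by
  rintro ⟨C, hC⟩
  have hp0 : 0 < p := by linarith
  set K : ℝ := |C| + 1 with hK
  have hK0 : 0 < K := by positivity
  -- choose N large
  have ht : Tendsto (fun N : ℕ => ((N : ℝ) / 5) ^ (p - 1)) atTop atTop :=
    (tendsto_rpow_atTop (by linarith)).comp
      (tendsto_natCast_atTop_atTop.atTop_div_const (by norm_num))
  obtain ⟨N, hN, hN3⟩ := ((ht.eventually_gt_atTop ((2 * K) ^ p * 2)).and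
    (eventually_ge_atTop 3)).exists
  obtain ⟨y, R, μ, hR0, hμR, hy, hε⟩ := good_family hE N hN3
  have hNr : (3:ℝ) ≤ N := by exact_mod_cast hN3
  have hμ0 : 0 < μ := lt_of_lt_of_le (by positivity) hμR
  have hlow : μ / 2 ≤ radNorm y := by
    rw [radNorm_eq]
    have : (μ / 2) ^ 2 ≤ 𝔼 ε : Fin (N ^ 2) → ℤˣ, ‖∑ j, sg (ε j) • y j‖ ^ 2 :=
      Finset.le_expect Finset.univ_nonempty fun ε _ => by
        have := (hε ε).1
        gcongr
    calc μ / 2 = ((μ / 2) ^ 2) ^ ((1:ℝ) / 2) := by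
          rw [← Real.sqrt_eq_rpow, Real.sqrt_sq (by positivity)]
      _ ≤ _ := Real.rpow_le_rpow (by positivity) this (by norm_num)
  have hup := weakNorm_le p hp y (2 * R) (2 * μ) (by positivity) hy (fun ε => (hε ε).2)
  have h1 : μ / 2 ≤ K * ((2 * R) ^ (p - 1) * (2 * μ)) ^ (1 / p) := by
    refine hlow.trans ((hC _ y).trans ?_)
    have hw := weakNorm_nonneg p y
    calc C * weakNorm p y ≤ K * weakNorm p y := by
          gcongr; linarith [le_abs_self C]
      _ ≤ _ := by gcongr
  have h2 : μ ≤ 2 * K * ((2 * R) ^ (p - 1) * (2 * μ)) ^ (1 / p) := by linarith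
  have h3 : μ ^ p ≤ (2 * K) ^ p * ((2 * R) ^ (p - 1) * (2 * μ)) := by
    have := Real.rpow_le_rpow hμ0.le h2 hp0.le
    rwa [Real.mul_rpow (by positivity) (by positivity), ← Real.rpow_mul (by positivity),
      one_div_mul_cancel hp0.ne', Real.rpow_one] at this
  have h4 : μ ^ p = μ ^ (p - 1) * μ := by
    rw [← Real.rpow_add_one hμ0.ne']; ring_nf
  have h5 : ((N:ℝ) / 5) ^ (p - 1) * (2 * R) ^ (p - 1) ≤ μ ^ (p - 1) := by
    rw [← Real.mul_rpow (by positivity) (by positivity)]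
    refine Real.rpow_le_rpow (by positivity) ?_ (by linarith)
    linarith
  have h6 : 0 < (2 * R) ^ (p - 1) := by positivity
  rw [h4] at h3
  have h7 : μ ^ (p - 1) ≤ (2 * K) ^ p * 2 * (2 * R) ^ (p - 1) := by
    refine le_of_mul_le_mul_right ?_ hμ0
    linarith
  have h8 := le_of_mul_le_mul_right (h5.trans h7) h6
  linarith
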